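/- With β = q + q^{−1}, the matrices A and A* satisfy the tridiagonal relations: A³A* − (β+1) A²A*A + (β+1) AA*A² − A*A³ = q^{N+M−2}(q+1)² (AA* − A*A), and (A*)²A − β A*AA* + A(A*)² = 0. -/

import Mathlib

open Module Matrix Finset

noncomputable section

open scoped Classical

variable {F H : Type} [Field F] [Fintype F] [AddCommGroup H] [Module F H]
  [FiniteDimensional F H]

/-- The vertex set of the Attenuated Space poset `A_q(N,M)`:
the subspaces of `H` that intersect `h` trivially. -/
def AttX (h : Submodule F H) := {y : Submodule F H // y ⊓ h = ⊥}

instance (h : Submodule F H) : Fintype (AttX h) := by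
  have : Finite H := Module.finite_of_finite F
  have : Finite (Submodule F H) :=
    Finite.of_injective (fun y : Submodule F H => (y : Set H)) SetLike.coe_injective
  have : Finite (AttX h) := Subtype.finite
  exact Fintype.ofFinite _

/-- The dimension of a vertex. -/
def vdim (h : Submodule F H) (y : AttX h) : ℕ := finrank F (y.1 : Submodule F H)

/-- `AttCovers h y z` means that `z` covers `y`: `y ⊆ z` and `dim z = dim y + 1`. -/
def AttCovers (h : Submodule F H) (y z : AttX h) : Prop :=
  y.1 ≤ z.1 ∧ vdim h z = vdim h y + 1

/-- The raising matrix `R`: `(y,z)`-entry `1` if `y` covers `z`, else `0`. -/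
def Rmat (h : Submodule F H) : Matrix (AttX h) (AttX h) ℂ :=
  fun y z => if AttCovers h z y then 1 else 0

/-- The lowering matrix `L'`: `(y,z)`-entry `1` if `z` covers `y`, else `0`. -/
def Lpmat (h : Submodule F H) : Matrix (AttX h) (AttX h) ℂ :=
  fun y z => if AttCovers h y z then 1 else 0

/-- The `q`-lowering matrix `L`: `(y,z)`-entry `q^(dim y)` if `z` covers `y`, else `0`. -/
def Lmat (h : Submodule F H) (q : ℕ) : Matrix (AttX h) (AttX h) ℂ :=
  fun y z => if AttCovers h y z then (q : ℂ) ^ (vdim h y) else 0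

/-- The `q`-adjacency matrix `A`: `(y,z)`-entry `1` if `y` covers `z`,
`q^(dim y)` if `z` covers `y`, and `0` otherwise. -/
def Amat (h : Submodule F H) (q : ℕ) : Matrix (AttX h) (AttX h) ℂ :=
  fun y z =>
    if AttCovers h z y then 1 else if AttCovers h y z then (q : ℂ) ^ (vdim h y) else 0

/-- The dual adjacency matrix `A*`: diagonal with `(y,y)`-entry `q^{-dim y}`. -/
def Astar (h : Submodule F H) (q : ℕ) : Matrix (AttX h) (AttX h) ℂ :=
  Matrix.diagonal fun y => (q : ℂ) ^ (-(vdim h y : ℤ))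

/-- The matrix `S`: diagonal with `(y,y)`-entry `(-1)^(dim y)`. -/
def Smat (h : Submodule F H) : Matrix (AttX h) (AttX h) ℂ :=
  Matrix.diagonal fun y => (-1 : ℂ) ^ (vdim h y)

/-- The matrix `E*_i`: diagonal with `(y,y)`-entry `1` if `dim y = i`, else `0`. -/
def Estar (h : Submodule F H) (i : ℕ) : Matrix (AttX h) (AttX h) ℂ :=
  Matrix.diagonal fun y => if vdim h y = i then (1 : ℂ) else 0

theorem ncard_sdiff_submodule {S T : Submodule F H} (hST : S ≤ T) :
    ((((T : Set H) \ S).ncard : ℕ) : ℂ)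
      = (Fintype.card F : ℂ) ^ finrank F T - (Fintype.card F : ℂ) ^ finrank F S := by
  have : Finite H := Module.finite_of_finite F
  have key : ∀ U : Submodule F H, (U : Set H).ncard = Fintype.card F ^ finrank F U := by
    intro U
    rw [← Nat.card_coe_set_eq, ← Nat.card_eq_fintype_card]
    exact Module.natCard_eq_pow_finrank (K := F) (V := U)
  rw [Set.cast_ncard_sdiff hST (Set.toFinite _), key, key]
  push_cast
  rfl

theorem ncard_covers_mul {z S T : Submodule F H} (hzS : z ≤ S) (hST : S ≤ T) :
    ({w : Submodule F H | z ≤ w ∧ finrank F w = finrank F z + 1 ∧ w ≤ T ∧ ¬ w ≤ S}.ncard : ℂ)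
        * ((Fintype.card F : ℂ) ^ finrank F z * ((Fintype.card F : ℂ) - 1))
      = (Fintype.card F : ℂ) ^ finrank F T - (Fintype.card F : ℂ) ^ finrank F S := by
  have : Finite H := Module.finite_of_finite F
  have : Finite (Submodule F H) :=
    Finite.of_injective (fun y : Submodule F H => (y : Set H)) SetLike.coe_injective
  have := Fintype.ofFinite H
  have := Fintype.ofFinite (Submodule F H)
  rw [← ncard_sdiff_submodule hST, Set.ncard_eq_toFinset_card', Set.ncard_eq_toFinset_card']
  have hmap : ∀ x ∈ ((T : Set H) \ S).toFinset, z ⊔ Submodule.span F {x} ∈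
      {w : Submodule F H | z ≤ w ∧ finrank F w = finrank F z + 1 ∧ w ≤ T ∧ ¬ w ≤ S}.toFinset := by
    intro x hx
    simp only [Set.mem_toFinset, Set.mem_sdiff, SetLike.mem_coe, Set.mem_ofPred_eq] at hx ⊢
    refine ⟨le_sup_left, Submodule.finrank_sup_span_singleton fun h => hx.2 (hzS h), ?_, ?_⟩
    · exact sup_le (hzS.trans hST) ((Submodule.span_singleton_le_iff_mem _ _).2 hx.1)
    · exact fun h => hx.2 ((Submodule.span_singleton_le_iff_mem _ _).1 (le_sup_right.trans h))
  rw [Finset.card_eq_sum_card_fiberwise hmap]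
  have hfib : ∀ w ∈
      {w : Submodule F H | z ≤ w ∧ finrank F w = finrank F z + 1 ∧ w ≤ T ∧ ¬ w ≤ S}.toFinset,
      (({x ∈ ((T : Set H) \ S).toFinset | z ⊔ Submodule.span F {x} = w}.card : ℕ) : ℂ)
        = (Fintype.card F : ℂ) ^ finrank F z * ((Fintype.card F : ℂ) - 1) := by
    intro w hw
    simp only [Set.mem_toFinset, Set.mem_ofPred_eq] at hw
    obtain ⟨hzw, hd, hwT, hwS⟩ := hw
    have hinf : w ⊓ S = z := by
      refine (Submodule.eq_of_le_of_finrank_le (le_inf hzw hzS) ?_).symm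
      have hlt : w ⊓ S < w := lt_of_le_of_ne inf_le_left fun h => hwS (inf_eq_left.1 h)
      have := Submodule.finrank_lt_finrank_of_lt hlt
      lia
    have hset : {x ∈ ((T : Set H) \ S).toFinset | z ⊔ Submodule.span F {x} = w}
        = ((w : Set H) \ z).toFinset := by
      ext x
      simp only [Finset.mem_filter, Set.mem_toFinset, Set.mem_sdiff, SetLike.mem_coe]
      constructor
      · rintro ⟨⟨-, hxS⟩, rfl⟩
        exact ⟨(le_sup_right : _ ≤ z ⊔ _) (Submodule.mem_span_singleton_self x),
          fun h => hxS (hzS h)⟩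
      · rintro ⟨hxw, hxz⟩
        refine ⟨⟨hwT hxw, fun h => hxz (hinf ▸ ⟨hxw, h⟩)⟩, ?_⟩
        refine Submodule.eq_of_le_of_finrank_le
          (sup_le hzw ((Submodule.span_singleton_le_iff_mem _ _).2 hxw)) ?_
        rw [hd, Submodule.finrank_sup_span_singleton hxz]
    rw [hset, ← Set.ncard_eq_toFinset_card', ncard_sdiff_submodule hzw, hd]
    ring
  push_cast
  rw [Finset.sum_congr rfl hfib, Finset.sum_const, nsmul_eq_mul]

theorem inf_eq_bot_iff_not_le_sup {h z w : Submodule F H} (hz : z ⊓ h = ⊥) (hzw : z ≤ w)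
    (hd : finrank F w = finrank F z + 1) : w ⊓ h = ⊥ ↔ ¬ w ≤ z ⊔ h := by
  constructor
  · intro hw hle
    have h1 : w = z := by
      calc w = (z ⊔ h) ⊓ w := (inf_eq_right.2 hle).symm
        _ = z ⊔ h ⊓ w := sup_inf_assoc_of_le h hzw
        _ = z := by rw [inf_comm, hw, sup_bot_eq]
    rw [h1] at hd
    lia
  · intro hle
    by_contra hne
    apply hle
    have hlt : z < z ⊔ w ⊓ h := by
      refine lt_of_le_of_ne le_sup_left fun heq => hne ?_
      have h1 : w ⊓ h ≤ z := by rw [heq]; exact le_sup_right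
      exact le_bot_iff.1 (hz ▸ le_inf h1 inf_le_right)
    have h2 := Submodule.finrank_lt_finrank_of_lt hlt
    have h3 : z ⊔ w ⊓ h = w :=
      Submodule.eq_of_le_of_finrank_le (sup_le hzw inf_le_left) (by lia)
    calc w = z ⊔ w ⊓ h := h3.symm
      _ ≤ z ⊔ h := sup_le_sup_left inf_le_right z

theorem card_field_ne_zero : (Fintype.card F : ℂ) ≠ 0 := by
  exact_mod_cast Fintype.card_ne_zero

theorem card_field_sub_one_ne_zero : (Fintype.card F : ℂ) - 1 ≠ 0 := by
  have := Fintype.one_lt_card (α := F)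
  rw [sub_ne_zero]
  exact_mod_cast this.ne'

theorem ncard_avoiding_covers_mul {h z : Submodule F H} (hz : z ⊓ h = ⊥) :
    ({w : Submodule F H | w ⊓ h = ⊥ ∧ z ≤ w ∧ finrank F w = finrank F z + 1}.ncard : ℂ)
        * ((Fintype.card F : ℂ) ^ finrank F z * ((Fintype.card F : ℂ) - 1))
      = (Fintype.card F : ℂ) ^ finrank F H
        - (Fintype.card F : ℂ) ^ (finrank F z + finrank F h) := by
  have hs := Submodule.finrank_sup_add_finrank_inf_eq z h
  rw [hz, finrank_bot, add_zero] at hs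
  rw [← hs, ← finrank_top F H, ← ncard_covers_mul (le_sup_left : z ≤ z ⊔ h) le_top]
  congr 4
  ext w
  simp only [le_top, true_and]
  constructor
  · rintro ⟨h1, h2, h3⟩
    exact ⟨h2, h3, (inf_eq_bot_iff_not_le_sup hz h2 h3).1 h1⟩
  · rintro ⟨h2, h3, h1⟩
    exact ⟨(inf_eq_bot_iff_not_le_sup hz h2 h3).2 h1, h2, h3⟩

theorem ncard_between {z w : Submodule F H} (hzw : z ≤ w)
    (hd : finrank F w = finrank F z + 2) :
    ({v : Submodule F H | z ≤ v ∧ finrank F v = finrank F z + 1 ∧ v ≤ w}.ncard : ℂ)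
      = Fintype.card F + 1 := by
  have h1 := ncard_covers_mul (le_refl z) hzw
  have hset : {v : Submodule F H | z ≤ v ∧ finrank F v = finrank F z + 1 ∧ v ≤ w ∧ ¬ v ≤ z}
      = {v : Submodule F H | z ≤ v ∧ finrank F v = finrank F z + 1 ∧ v ≤ w} := by
    ext v
    simp only [Set.mem_ofPred_eq]
    refine ⟨fun ⟨a, b, c, _⟩ => ⟨a, b, c⟩, fun ⟨a, b, c⟩ => ⟨a, b, c, fun d => ?_⟩⟩
    have := Submodule.finrank_mono d
    lia
  rw [hset, hd] at h1
  have hne : (Fintype.card F : ℂ) ^ finrank F z * ((Fintype.card F : ℂ) - 1) ≠ 0 :=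
    mul_ne_zero (pow_ne_zero _ card_field_ne_zero) card_field_sub_one_ne_zero
  apply mul_right_cancel₀ hne
  rw [h1]
  ring

theorem inf_eq_bot_mono {h y z : Submodule F H} (hyz : y ≤ z) (hz : z ⊓ h = ⊥) : y ⊓ h = ⊥ :=
  le_bot_iff.1 (hz ▸ inf_le_inf_right h hyz)

theorem ncard_adjacent_of_le {h y z : Submodule F H} (hy : y ⊓ h = ⊥)
    (hd : finrank F y = finrank F z + 1) (hzy : z ≤ y) :
    ({v : Submodule F H | v ⊓ h = ⊥ ∧ (v ≤ y ∧ finrank F y = finrank F v + 1) ∧ v ≠ z ∧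
        finrank F v = finrank F z ∧ finrank F (v ⊔ z : Submodule F H) = finrank F z + 1 ∧
        (v ⊔ z) ⊓ h = ⊥}.ncard : ℂ)
      = Fintype.card F * ({u : Submodule F H | u ⊓ h = ⊥ ∧
        (u ≤ y ∧ finrank F y = finrank F u + 2) ∧ u ≤ z ∧
        finrank F z = finrank F u + 1}.ncard : ℂ) := by
  have : Finite H := Module.finite_of_finite F
  have : Finite (Submodule F H) :=
    Finite.of_injective (fun y : Submodule F H => (y : Set H)) SetLike.coe_injective
  have := Fintype.ofFinite (Submodule F H)
  rw [Set.ncard_eq_toFinset_card', Set.ncard_eq_toFinset_card']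
  rw [Finset.card_eq_sum_card_fiberwise (f := fun v => v ⊓ z)
    (t := {u : Submodule F H | u ⊓ h = ⊥ ∧
        (u ≤ y ∧ finrank F y = finrank F u + 2) ∧ u ≤ z ∧
        finrank F z = finrank F u + 1}.toFinset)]
  · push_cast
    rw [Finset.sum_congr rfl (g := fun _ => (Fintype.card F : ℂ)), Finset.sum_const, nsmul_eq_mul,
      mul_comm]
    intro u hu
    simp only [Set.mem_toFinset, Set.mem_ofPred_eq] at hu
    obtain ⟨-, ⟨huy, hyu⟩, huz, hzu⟩ := hu
    have h1 := ncard_covers_mul huz hzy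
    have hne : (Fintype.card F : ℂ) ^ finrank F u * ((Fintype.card F : ℂ) - 1) ≠ 0 :=
      mul_ne_zero (pow_ne_zero _ card_field_ne_zero) card_field_sub_one_ne_zero
    apply mul_right_cancel₀ hne
    rw [hyu, hzu] at h1
    rw [show (Fintype.card F : ℂ) * ((Fintype.card F : ℂ) ^ finrank F u * (Fintype.card F - 1))
      = (Fintype.card F : ℂ) ^ (finrank F u + 2) - (Fintype.card F : ℂ) ^ (finrank F u + 1) by ring,
      ← h1, Set.ncard_eq_toFinset_card']
    congr 3
    ext v
    simp only [Finset.mem_filter, Set.mem_toFinset, Set.mem_ofPred_eq]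
    constructor
    · rintro ⟨⟨-, ⟨hvy, hyv⟩, hvne, hvz, -, -⟩, rfl⟩
      exact ⟨inf_le_left, by lia, hvy, fun hle =>
        hvne (Submodule.eq_of_le_of_finrank_le hle (by lia))⟩
    · rintro ⟨huv, hvu, hvy, hvz⟩
      have hsup : v ⊔ z = y := by
        refine Submodule.eq_of_le_of_finrank_le (sup_le hvy hzy) ?_
        have hlt : z < v ⊔ z := lt_of_le_of_ne le_sup_right fun heq =>
          hvz (heq ▸ le_sup_left)
        have := Submodule.finrank_lt_finrank_of_lt hlt
        lia
      have hinf : v ⊓ z = u := by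
        refine (Submodule.eq_of_le_of_finrank_le (le_inf huv huz) ?_).symm
        have := Submodule.finrank_sup_add_finrank_inf_eq v z
        rw [hsup] at this
        lia
      refine ⟨⟨inf_eq_bot_mono hvy hy, ⟨hvy, by lia⟩, ?_, by lia, ?_, ?_⟩, hinf⟩
      · rintro rfl
        exact hvz le_rfl
      · rw [hsup, hd]
      · rw [hsup, hy]
  · intro v hv
    simp only [Set.mem_toFinset, Set.mem_ofPred_eq, Finset.mem_coe] at hv ⊢
    obtain ⟨hv, ⟨hvy, hyv⟩, hne, hvz, hs, -⟩ := hv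
    have := Submodule.finrank_sup_add_finrank_inf_eq v z
    exact ⟨inf_eq_bot_mono inf_le_left hv, ⟨inf_le_left.trans hvy, by lia⟩, inf_le_right, by lia⟩

theorem ncard_adjacent_of_not_le {h y z : Submodule F H} (hy : y ⊓ h = ⊥) (hz : z ⊓ h = ⊥)
    (hd : finrank F y = finrank F z + 1) (hzy : ¬ z ≤ y) :
    ({v : Submodule F H | v ⊓ h = ⊥ ∧ (v ≤ y ∧ finrank F y = finrank F v + 1) ∧ v ≠ z ∧
        finrank F v = finrank F z ∧ finrank F (v ⊔ z : Submodule F H) = finrank F z + 1 ∧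
        (v ⊔ z) ⊓ h = ⊥}.ncard : ℂ)
      = Fintype.card F * ({u : Submodule F H | u ⊓ h = ⊥ ∧
        (u ≤ y ∧ finrank F y = finrank F u + 2) ∧ u ≤ z ∧
        finrank F z = finrank F u + 1}.ncard : ℂ)
        + ({w : Submodule F H | w ⊓ h = ⊥ ∧ (y ≤ w ∧ finrank F w = finrank F y + 1) ∧
          z ≤ w ∧ finrank F w = finrank F z + 2}.ncard : ℂ) := by
  have hsi := Submodule.finrank_sup_add_finrank_inf_eq y z
  by_cases hu : finrank F z = finrank F (y ⊓ z : Submodule F H) + 1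
  swap
  · have hlt : y ⊓ z < z := lt_of_le_of_ne inf_le_right fun heq => hzy (heq ▸ inf_le_left)
    have hlt' := Submodule.finrank_lt_finrank_of_lt hlt
    rw [Set.eq_empty_of_forall_notMem (s := {v : Submodule F H | v ⊓ h = ⊥ ∧ _}),
      Set.eq_empty_of_forall_notMem (s := {u : Submodule F H | u ⊓ h = ⊥ ∧ (u ≤ y ∧ _) ∧ _}),
      Set.eq_empty_of_forall_notMem (s := {w : Submodule F H | w ⊓ h = ⊥ ∧ (y ≤ w ∧ _) ∧ _})]
    · simp
    · rintro w ⟨-, ⟨hyw, hw⟩, hzw, -⟩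
      have := Submodule.finrank_mono (sup_le hyw hzw)
      lia
    · rintro u ⟨-, ⟨huy, -⟩, huz, hzu⟩
      have := Submodule.finrank_mono (le_inf huy huz)
      lia
    · rintro v ⟨-, ⟨hvy, -⟩, -, hvz, hs, -⟩
      have h1 := Submodule.finrank_sup_add_finrank_inf_eq v z
      have h2 := Submodule.finrank_mono (inf_le_inf_right z hvy)
      lia
  have hU : {u : Submodule F H | u ⊓ h = ⊥ ∧ (u ≤ y ∧ finrank F y = finrank F u + 2) ∧ u ≤ z ∧
        finrank F z = finrank F u + 1} = {y ⊓ z} := by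
    ext u
    simp only [Set.mem_ofPred_eq, Set.mem_singleton_iff]
    constructor
    · rintro ⟨-, ⟨huy, -⟩, huz, hzu⟩
      exact Submodule.eq_of_le_of_finrank_le (le_inf huy huz) (by lia)
    · rintro rfl
      exact ⟨inf_eq_bot_mono inf_le_left hy, ⟨inf_le_left, by lia⟩, inf_le_right, hu⟩
  have hV : {v : Submodule F H | v ⊓ h = ⊥ ∧ (v ≤ y ∧ finrank F y = finrank F v + 1) ∧ v ≠ z ∧
        finrank F v = finrank F z ∧ finrank F (v ⊔ z : Submodule F H) = finrank F z + 1 ∧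
        (v ⊔ z) ⊓ h = ⊥} = {v : Submodule F H | y ⊓ z ≤ v ∧
        finrank F v = finrank F (y ⊓ z : Submodule F H) + 1 ∧ v ≤ y ∧ ¬ v ≤ y ⊓ (z ⊔ h)} := by
    ext v
    simp only [Set.mem_ofPred_eq]
    have h1 := Submodule.finrank_sup_add_finrank_inf_eq v z
    constructor
    · rintro ⟨-, ⟨hvy, hyv⟩, -, hvz, hs, ha⟩
      have h2 : v ⊓ z = y ⊓ z :=
        Submodule.eq_of_le_of_finrank_le (inf_le_inf_right z hvy) (by lia)
      refine ⟨h2 ▸ inf_le_left, by lia, hvy, fun hle => ?_⟩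
      exact (inf_eq_bot_iff_not_le_sup hz le_sup_right hs).1 ha
        (sup_le (hle.trans inf_le_right) le_sup_left)
    · rintro ⟨huv, hvu, hvy, hle⟩
      have hne : v ≠ z := by
        rintro rfl
        exact hzy hvy
      have h2 : v ⊓ z = y ⊓ z := by
        refine (Submodule.eq_of_le_of_finrank_le (le_inf huv inf_le_right) ?_).symm
        have h3 : v ⊓ z < z := lt_of_le_of_ne inf_le_right fun heq =>
          hzy ((heq ▸ inf_le_left : z ≤ v).trans hvy)
        have := Submodule.finrank_lt_finrank_of_lt h3
        lia
      rw [h2] at h1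
      have hs : finrank F (v ⊔ z : Submodule F H) = finrank F z + 1 := by lia
      refine ⟨inf_eq_bot_mono hvy hy, ⟨hvy, by lia⟩, hne, by lia, hs, ?_⟩
      exact (inf_eq_bot_iff_not_le_sup hz le_sup_right hs).2 fun h4 =>
        hle (le_inf hvy (le_sup_left.trans h4))
  have hS : finrank F (y ⊓ (z ⊔ h) : Submodule F H) + 1
      = finrank F z + finrank F ((y ⊔ z) ⊓ h : Submodule F H) := by
    have hB : (y ⊔ z) ⊓ (z ⊔ h) = z ⊔ (y ⊔ z) ⊓ h := by
      rw [inf_comm, sup_inf_assoc_of_le h (le_sup_right : z ≤ y ⊔ z), inf_comm h]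
    have h1 := Submodule.finrank_sup_add_finrank_inf_eq z ((y ⊔ z) ⊓ h)
    have h2 : z ⊓ ((y ⊔ z) ⊓ h) = ⊥ :=
      le_bot_iff.1 (hz ▸ inf_le_inf_left z inf_le_right)
    rw [h2, finrank_bot] at h1
    have h3 := Submodule.finrank_sup_add_finrank_inf_eq y (z ⊔ (y ⊔ z) ⊓ h)
    have h4 : y ⊔ (z ⊔ (y ⊔ z) ⊓ h) = y ⊔ z := by
      rw [← sup_assoc]
      exact sup_eq_left.2 inf_le_left
    have h5 : y ⊓ (z ⊔ (y ⊔ z) ⊓ h) = y ⊓ (z ⊔ h) := by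
      rw [← hB, ← inf_assoc, inf_eq_left.2 (le_sup_left : y ≤ y ⊔ z)]
    rw [h4, h5] at h3
    lia
  have hk : finrank F ((y ⊔ z) ⊓ h : Submodule F H) ≤ 1 := by
    have h1 := Submodule.finrank_sup_add_finrank_inf_eq y ((y ⊔ z) ⊓ h)
    have h2 : y ⊓ ((y ⊔ z) ⊓ h) = ⊥ :=
      le_bot_iff.1 (hy ▸ inf_le_inf_left y inf_le_right)
    rw [h2, finrank_bot] at h1
    have h3 := Submodule.finrank_mono (sup_le le_sup_left inf_le_left : y ⊔ (y ⊔ z) ⊓ h ≤ y ⊔ z)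
    lia
  have hcount := ncard_covers_mul
    (le_inf inf_le_left (inf_le_right.trans le_sup_left) : y ⊓ z ≤ y ⊓ (z ⊔ h))
    (inf_le_left : y ⊓ (z ⊔ h) ≤ y)
  have hne : (Fintype.card F : ℂ) ^ finrank F (y ⊓ z : Submodule F H)
      * ((Fintype.card F : ℂ) - 1) ≠ 0 :=
    mul_ne_zero (pow_ne_zero _ card_field_ne_zero) card_field_sub_one_ne_zero
  apply mul_right_cancel₀ hne
  rw [hU, hV, hcount, Set.ncard_singleton]
  by_cases ha : (y ⊔ z) ⊓ h = ⊥
  · have hW : {w : Submodule F H | w ⊓ h = ⊥ ∧ (y ≤ w ∧ finrank F w = finrank F y + 1) ∧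
          z ≤ w ∧ finrank F w = finrank F z + 2} = {y ⊔ z} := by
      ext w
      simp only [Set.mem_ofPred_eq, Set.mem_singleton_iff]
      constructor
      · rintro ⟨-, ⟨hyw, hw⟩, hzw, -⟩
        exact (Submodule.eq_of_le_of_finrank_le (sup_le hyw hzw) (by lia)).symm
      · rintro rfl
        exact ⟨ha, ⟨le_sup_left, by lia⟩, le_sup_right, by lia⟩
    rw [ha, finrank_bot] at hS
    rw [hW, Set.ncard_singleton, show finrank F (y ⊓ (z ⊔ h) : Submodule F H)
      = finrank F (y ⊓ z : Submodule F H) by lia, hd, hu]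
    push_cast
    ring
  · have hW : {w : Submodule F H | w ⊓ h = ⊥ ∧ (y ≤ w ∧ finrank F w = finrank F y + 1) ∧
          z ≤ w ∧ finrank F w = finrank F z + 2} = ∅ := by
      refine Set.eq_empty_of_forall_notMem ?_
      rintro w ⟨haw, ⟨hyw, hw⟩, hzw, -⟩
      exact ha (inf_eq_bot_mono (sup_le hyw hzw) haw)
    have hpos : finrank F ((y ⊔ z) ⊓ h : Submodule F H) ≠ 0 := fun h0 =>
      ha (Submodule.finrank_eq_zero.1 h0)
    rw [hW, Set.ncard_empty, show finrank F (y ⊓ (z ⊔ h) : Submodule F H)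
      = finrank F (y ⊓ z : Submodule F H) + 1 by lia, hd, hu]
    push_cast
    ring

theorem sum_attX_ite {h : Submodule F H} (P : Submodule F H → Prop) [DecidablePred P] :
    ∑ v : AttX h, (if P v.1 then (1 : ℂ) else 0)
      = ({v : Submodule F H | v ⊓ h = ⊥ ∧ P v}.ncard : ℂ) := by
  rw [Finset.sum_boole]
  congr 1
  rw [← Set.ncard_coe_finset]
  refine (Set.ncard_image_of_injective _ Subtype.val_injective).symm.trans ?_
  congr 1
  ext v
  simp only [Finset.coe_filter, Finset.mem_univ, true_and, Set.mem_ofPred_eq]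
  exact ⟨fun ⟨x, hx, hv⟩ => hv ▸ ⟨x.2, hx⟩, fun ⟨h1, h2⟩ => ⟨⟨v, h1⟩, h2, rfl⟩⟩

theorem Rmat_apply {h : Submodule F H} (y z : AttX h) :
    Rmat h y z = if z.1 ≤ y.1 ∧ finrank F y.1 = finrank F z.1 + 1 then 1 else 0 :=
  if_congr Iff.rfl rfl rfl

theorem Lpmat_apply {h : Submodule F H} (y z : AttX h) :
    Lpmat h y z = if y.1 ≤ z.1 ∧ finrank F z.1 = finrank F y.1 + 1 then 1 else 0 :=
  if_congr Iff.rfl rfl rfl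

theorem Rmat_mul_Rmat_apply {h : Submodule F H} (w z : AttX h) :
    (Rmat h * Rmat h) w z = if z.1 ≤ w.1 ∧ finrank F w.1 = finrank F z.1 + 2 then
      (Fintype.card F : ℂ) + 1 else 0 := by
  have h1 : (Rmat h * Rmat h) w z = ∑ v : AttX h,
      if ((v.1 ≤ w.1 ∧ finrank F w.1 = finrank F v.1 + 1)
      ∧ z.1 ≤ v.1 ∧ finrank F v.1 = finrank F z.1 + 1) then (1 : ℂ) else 0 := by
    rw [Matrix.mul_apply]
    refine Finset.sum_congr rfl fun v _ => ?_
    simp only [Rmat_apply, ite_zero_mul_ite_zero, one_mul]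
  refine (h1.trans (sum_attX_ite fun v => (v ≤ w.1 ∧ finrank F w.1 = finrank F v + 1)
      ∧ z.1 ≤ v ∧ finrank F v = finrank F z.1 + 1)).trans ?_
  split_ifs with hc
  · rw [← ncard_between hc.1 hc.2]
    congr 2
    ext v
    simp only [Set.mem_ofPred_eq]
    exact ⟨fun ⟨_, ⟨a, _⟩, b, c⟩ => ⟨b, c, a⟩, fun ⟨b, c, a⟩ =>
      ⟨inf_eq_bot_mono a w.2, ⟨a, by lia⟩, b, c⟩⟩
  · refine (congrArg (fun s : Set (Submodule F H) => (s.ncard : ℂ))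
      (Set.eq_empty_of_forall_notMem ?_)).trans (by simp)
    rintro v ⟨-, ⟨a, b⟩, c, d⟩
    exact hc ⟨c.trans a, by lia⟩

theorem Lpmat_mul_Rmat_apply {h : Submodule F H} (v z : AttX h) :
    (Lpmat h * Rmat h) v z = (if v = z then
        ({w : Submodule F H | w ⊓ h = ⊥ ∧ z.1 ≤ w ∧ finrank F w = finrank F z.1 + 1}.ncard : ℂ)
        else 0)
      + if v.1 ≠ z.1 ∧ finrank F v.1 = finrank F z.1 ∧
          finrank F (v.1 ⊔ z.1 : Submodule F H) = finrank F z.1 + 1 ∧ (v.1 ⊔ z.1) ⊓ h = ⊥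
        then 1 else 0 := by
  have h1 : (Lpmat h * Rmat h) v z = ∑ w : AttX h,
      if ((v.1 ≤ w.1 ∧ finrank F w.1 = finrank F v.1 + 1)
        ∧ z.1 ≤ w.1 ∧ finrank F w.1 = finrank F z.1 + 1) then (1 : ℂ) else 0 := by
    rw [Matrix.mul_apply]
    refine Finset.sum_congr rfl fun w _ => ?_
    simp only [Rmat_apply, Lpmat_apply, ite_zero_mul_ite_zero, one_mul]
  refine (h1.trans (sum_attX_ite fun w => (v.1 ≤ w ∧ finrank F w = finrank F v.1 + 1)
      ∧ z.1 ≤ w ∧ finrank F w = finrank F z.1 + 1)).trans ?_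
  by_cases hvz : v = z
  · subst hvz
    simp
  · have hne : v.1 ≠ z.1 := fun heq => hvz (Subtype.ext heq)
    have hle : ∀ w : Submodule F H, v.1 ≤ w → finrank F w = finrank F v.1 + 1 →
        z.1 ≤ w → finrank F w = finrank F z.1 + 1 → v.1 ⊔ z.1 = w := by
      intro w a b c d
      refine Submodule.eq_of_le_of_finrank_le (sup_le a c) ?_
      have hlt : z.1 < v.1 ⊔ z.1 := lt_of_le_of_ne le_sup_right fun heq =>
        hne (Submodule.eq_of_le_of_finrank_le (heq ▸ le_sup_left) (by lia))
      have := Submodule.finrank_lt_finrank_of_lt hlt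
      lia
    rw [if_neg hvz, zero_add]
    split_ifs with hc
    · obtain ⟨-, h2, h3, h4⟩ := hc
      refine (congrArg (fun s : Set (Submodule F H) => (s.ncard : ℂ))
        (?_ : _ = {v.1 ⊔ z.1})).trans (by simp)
      ext w
      simp only [Set.mem_ofPred_eq, Set.mem_singleton_iff]
      constructor
      · rintro ⟨-, ⟨a, b⟩, c, d⟩
        exact (hle w a b c d).symm
      · rintro rfl
        exact ⟨h4, ⟨le_sup_left, by lia⟩, le_sup_right, h3⟩
    · refine (congrArg (fun s : Set (Submodule F H) => (s.ncard : ℂ))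
        (Set.eq_empty_of_forall_notMem ?_)).trans (by simp)
      rintro w ⟨e, ⟨a, b⟩, c, d⟩
      have := hle w a b c d
      exact hc ⟨hne, by lia, by rw [this, d], by rw [this, e]⟩

theorem Lpmat_Rmat_Rmat_apply {h : Submodule F H} (y z : AttX h) :
    (Lpmat h * (Rmat h * Rmat h)) y z = ((Fintype.card F : ℂ) + 1) *
      ({w : Submodule F H | w ⊓ h = ⊥ ∧ (y.1 ≤ w ∧ finrank F w = finrank F y.1 + 1) ∧
          z.1 ≤ w ∧ finrank F w = finrank F z.1 + 2}.ncard : ℂ) := by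
  rw [Matrix.mul_apply, ← sum_attX_ite fun w => (y.1 ≤ w ∧ finrank F w = finrank F y.1 + 1) ∧
          z.1 ≤ w ∧ finrank F w = finrank F z.1 + 2, Finset.mul_sum]
  refine Finset.sum_congr rfl fun w _ => ?_
  rw [Rmat_mul_Rmat_apply]
  simp only [Lpmat_apply, ite_and, mul_ite, mul_one, mul_zero]
  split_ifs <;> simp

theorem Rmat_Rmat_Lpmat_apply {h : Submodule F H} (y z : AttX h) :
    (Rmat h * (Rmat h * Lpmat h)) y z = ((Fintype.card F : ℂ) + 1) *
      ({u : Submodule F H | u ⊓ h = ⊥ ∧ (u ≤ y.1 ∧ finrank F y.1 = finrank F u + 2) ∧ u ≤ z.1 ∧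
        finrank F z.1 = finrank F u + 1}.ncard : ℂ) := by
  rw [← mul_assoc, Matrix.mul_apply,
    ← sum_attX_ite fun u => (u ≤ y.1 ∧ finrank F y.1 = finrank F u + 2) ∧ u ≤ z.1 ∧
        finrank F z.1 = finrank F u + 1, Finset.mul_sum]
  refine Finset.sum_congr rfl fun w _ => ?_
  rw [Rmat_mul_Rmat_apply]
  simp only [Lpmat_apply, ite_and, mul_ite, mul_one, mul_zero]
  split_ifs <;> rfl

theorem Rmat_Lpmat_Rmat_apply {h : Submodule F H} (y z : AttX h) :
    (Rmat h * (Lpmat h * Rmat h)) y z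
      = (if z.1 ≤ y.1 ∧ finrank F y.1 = finrank F z.1 + 1 then
        ({w : Submodule F H | w ⊓ h = ⊥ ∧ z.1 ≤ w ∧ finrank F w = finrank F z.1 + 1}.ncard : ℂ)
        else 0)
      + ({v : Submodule F H | v ⊓ h = ⊥ ∧ (v ≤ y.1 ∧ finrank F y.1 = finrank F v + 1) ∧
        v ≠ z.1 ∧ finrank F v = finrank F z.1 ∧
        finrank F (v ⊔ z.1 : Submodule F H) = finrank F z.1 + 1 ∧
        (v ⊔ z.1) ⊓ h = ⊥}.ncard : ℂ) := by
  rw [Matrix.mul_apply, ← sum_attX_ite fun v => (v ≤ y.1 ∧ finrank F y.1 = finrank F v + 1) ∧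
        v ≠ z.1 ∧ finrank F v = finrank F z.1 ∧
        finrank F (v ⊔ z.1 : Submodule F H) = finrank F z.1 + 1 ∧
        (v ⊔ z.1) ⊓ h = ⊥]
  simp only [Lpmat_mul_Rmat_apply, mul_add, Finset.sum_add_distrib]
  congr 1
  · simp [Rmat_apply]
  · refine Finset.sum_congr rfl fun v _ => ?_
    simp only [Rmat_apply, ite_zero_mul_ite_zero, one_mul]

theorem down_up_relation (h : Submodule F H) :
    Lpmat h * (Rmat h * Rmat h) - ((Fintype.card F : ℂ) + 1) • (Rmat h * (Lpmat h * Rmat h))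
        + (Fintype.card F : ℂ) • (Rmat h * (Rmat h * Lpmat h))
      = (-((Fintype.card F : ℂ) + 1) * (Fintype.card F : ℂ) ^ finrank F H
          * (Fintype.card F : ℂ)⁻¹) • (Rmat h * Astar h (Fintype.card F)) := by
  ext y z
  have hq := card_field_ne_zero (F := F)
  have hq1 := card_field_sub_one_ne_zero (F := F)
  have hRK : (Rmat h * Astar h (Fintype.card F)) y z
      = if z.1 ≤ y.1 ∧ finrank F y.1 = finrank F z.1 + 1
        then ((Fintype.card F : ℂ) ^ finrank F z.1)⁻¹ else 0 := by
    simp [Rmat_apply, Astar, vdim]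
  simp only [Matrix.add_apply, Matrix.sub_apply, Matrix.smul_apply, smul_eq_mul,
    Lpmat_Rmat_Rmat_apply, Rmat_Rmat_Lpmat_apply, Rmat_Lpmat_Rmat_apply, hRK]
  by_cases hd : finrank F y.1 = finrank F z.1 + 1
  · by_cases hzy : z.1 ≤ y.1
    · rw [if_pos ⟨hzy, hd⟩, if_pos ⟨hzy, hd⟩, ncard_adjacent_of_le y.2 hd hzy]
      have hW : {w : Submodule F H | w ⊓ h = ⊥ ∧ (y.1 ≤ w ∧ finrank F w = finrank F y.1 + 1) ∧
          z.1 ≤ w ∧ finrank F w = finrank F z.1 + 2}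
          = {w : Submodule F H | w ⊓ h = ⊥ ∧ y.1 ≤ w ∧ finrank F w = finrank F y.1 + 1} := by
        ext w
        simp only [Set.mem_ofPred_eq]
        exact ⟨fun ⟨a, b, _⟩ => ⟨a, b⟩, fun ⟨a, b, c⟩ => ⟨a, ⟨b, c⟩, hzy.trans b, by lia⟩⟩
      have h1 := ncard_avoiding_covers_mul y.2
      have h2 := ncard_avoiding_covers_mul z.2
      rw [hW]
      generalize ({w : Submodule F H | w ⊓ h = ⊥ ∧ y.1 ≤ w ∧
        finrank F w = finrank F y.1 + 1}.ncard : ℂ) = a at *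
      generalize ({w : Submodule F H | w ⊓ h = ⊥ ∧ z.1 ≤ w ∧
        finrank F w = finrank F z.1 + 1}.ncard : ℂ) = b at *
      rw [hd] at h1
      have hne : (Fintype.card F : ℂ) * ((Fintype.card F : ℂ) ^ finrank F z.1
          * ((Fintype.card F : ℂ) - 1)) ≠ 0 :=
        mul_ne_zero hq (mul_ne_zero (pow_ne_zero _ hq) hq1)
      apply mul_right_cancel₀ hne
      have hrhs : -((Fintype.card F : ℂ) + 1) * (Fintype.card F : ℂ) ^ finrank F H
          * (Fintype.card F : ℂ)⁻¹ * ((Fintype.card F : ℂ) ^ finrank F z.1)⁻¹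
          * ((Fintype.card F : ℂ) * ((Fintype.card F : ℂ) ^ finrank F z.1
          * ((Fintype.card F : ℂ) - 1))) = -((Fintype.card F : ℂ) + 1)
          * (Fintype.card F : ℂ) ^ finrank F H * ((Fintype.card F : ℂ) - 1) := by
        field_simp
      rw [hrhs]
      linear_combination ((Fintype.card F : ℂ) + 1) * h1
        - (Fintype.card F : ℂ) * ((Fintype.card F : ℂ) + 1) * h2
    · rw [if_neg fun hc => hzy hc.1, if_neg fun hc => hzy hc.1,
        ncard_adjacent_of_not_le y.2 z.2 hd hzy]
      ring
  · rw [if_neg fun hc => hd hc.2, if_neg fun hc => hd hc.2,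
      Set.eq_empty_of_forall_notMem
        (s := {v : Submodule F H | v ⊓ h = ⊥ ∧ (v ≤ y.1 ∧ _) ∧ v ≠ _ ∧ _}),
      Set.eq_empty_of_forall_notMem
        (s := {u : Submodule F H | u ⊓ h = ⊥ ∧ (u ≤ y.1 ∧ _) ∧ u ≤ _ ∧ _}),
      Set.eq_empty_of_forall_notMem (s := {w : Submodule F H | w ⊓ h = ⊥ ∧ (y.1 ≤ w ∧ _) ∧ _})]
    · simp
    · rintro w ⟨-, ⟨-, a⟩, -, b⟩
      lia
    · rintro u ⟨-, ⟨-, a⟩, -, b⟩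
      lia
    · rintro v ⟨-, ⟨-, a⟩, -, b, -⟩
      lia

theorem Rmat_transpose (h : Submodule F H) : (Rmat h)ᵀ = Lpmat h := rfl

theorem Lpmat_transpose (h : Submodule F H) : (Lpmat h)ᵀ = Rmat h := rfl

theorem Astar_transpose (h : Submodule F H) (q : ℕ) : (Astar h q)ᵀ = Astar h q :=
  Matrix.diagonal_transpose _

theorem down_up_relation_transpose (h : Submodule F H) :
    Lpmat h * (Lpmat h * Rmat h) - ((Fintype.card F : ℂ) + 1) • (Lpmat h * (Rmat h * Lpmat h))
        + (Fintype.card F : ℂ) • (Rmat h * (Lpmat h * Lpmat h))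
      = (-((Fintype.card F : ℂ) + 1) * (Fintype.card F : ℂ) ^ finrank F H
          * (Fintype.card F : ℂ)⁻¹) • (Astar h (Fintype.card F) * Lpmat h) := by
  have := congrArg Matrix.transpose (down_up_relation h)
  simpa only [Matrix.transpose_add, Matrix.transpose_sub, Matrix.transpose_smul,
    Matrix.transpose_mul, Rmat_transpose, Lpmat_transpose, Astar_transpose, mul_assoc] using this

theorem Amat_eq_add (h : Submodule F H) (q : ℕ) : Amat h q = Rmat h + Lmat h q := by
  ext y z
  simp only [Amat, Rmat, Lmat, Matrix.add_apply]
  split_ifs with h1 h2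
  · have := h1.2
    have := h2.2
    lia
  all_goals simp

theorem Lpmat_eq_mul (h : Submodule F H) {q : ℕ} (hq : (q : ℂ) ≠ 0) :
    Lpmat h = Astar h q * Lmat h q := by
  ext y z
  simp only [Astar, Lpmat, Lmat, Matrix.diagonal_mul]
  split_ifs <;> simp [hq]

theorem Rmat_mul_Astar (h : Submodule F H) {q : ℕ} (hq : (q : ℂ) ≠ 0) :
    Rmat h * Astar h q = (q : ℂ) • (Astar h q * Rmat h) := by
  ext y z
  simp only [Astar, Rmat, Matrix.diagonal_mul, Matrix.mul_diagonal, Matrix.smul_apply, smul_eq_mul]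
  split_ifs with hc
  · rw [hc.2]
    simp only [_root_.zpow_neg, zpow_natCast]
    field_simp
    ring
  · simp

theorem Lmat_mul_Astar (h : Submodule F H) {q : ℕ} (hq : (q : ℂ) ≠ 0) :
    Lmat h q * Astar h q = (q : ℂ)⁻¹ • (Astar h q * Lmat h q) := by
  ext y z
  simp only [Astar, Lmat, Matrix.diagonal_mul, Matrix.mul_diagonal, Matrix.smul_apply, smul_eq_mul]
  split_ifs with hc
  · rw [hc.2]
    simp only [_root_.zpow_neg, zpow_natCast]
    field_simp
    ring
  · simp

/-- with `β = q + q⁻¹`, the tridiagonal relations for `A` and `A*`. -/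
theorem stmt6 (q N M : ℕ) (hq : Fintype.card F = q) (hN : 0 < N) (hM : 0 < M)
    (h : Submodule F H) (hH : finrank F H = N + M) (hh : finrank F h = M)
    (β : ℂ) (hβ : β = (q : ℂ) + (q : ℂ)⁻¹) :
    Amat h q ^ 3 * Astar h q - (β + 1) • (Amat h q ^ 2 * Astar h q * Amat h q)
        + (β + 1) • (Amat h q * Astar h q * Amat h q ^ 2) - Astar h q * Amat h q ^ 3
      = ((q : ℂ) ^ (N + M - 2) * ((q : ℂ) + 1) ^ 2) •
          (Amat h q * Astar h q - Astar h q * Amat h q) ∧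
    Astar h q ^ 2 * Amat h q - β • (Astar h q * Amat h q * Astar h q)
        + Amat h q * Astar h q ^ 2 = 0 := by
  subst hq hβ
  have hq := card_field_ne_zero (F := F)
  have hR := Rmat_mul_Astar h hq
  have hL := Lmat_mul_Astar h hq
  have hE := down_up_relation h
  have hE' := down_up_relation_transpose h
  rw [Lpmat_eq_mul h hq] at hE hE'
  rw [Amat_eq_add]
  obtain ⟨n, hn⟩ : ∃ n, N + M = n + 2 := ⟨N + M - 2, by lia⟩
  rw [hH, hn] at hE hE'
  rw [hn, Nat.add_sub_cancel]
  obtain ⟨D, hD⟩ : ∃ D : Matrix (AttX h) (AttX h) ℂ, D * Astar h (Fintype.card F) = 1 := by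
    refine ⟨Matrix.diagonal fun y => (Fintype.card F : ℂ) ^ vdim h y, ?_⟩
    rw [Astar, Matrix.diagonal_mul_diagonal, ← Matrix.diagonal_one]
    congr 1
    ext y
    simp [hq]
  generalize Rmat h = R at *
  generalize Lmat h (Fintype.card F) = L at *
  generalize Astar h (Fintype.card F) = K at *
  generalize (Fintype.card F : ℂ) = q at *
  have hR' : ∀ X, R * (K * X) = q • (K * (R * X)) := fun X => by
    rw [← mul_assoc, hR, smul_mul_assoc, mul_assoc]
  have hL' : ∀ X, L * (K * X) = q⁻¹ • (K * (L * X)) := fun X => by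
    rw [← mul_assoc, hL, smul_mul_assoc, mul_assoc]
  simp only [mul_assoc, hR, hR', hL', mul_smul_comm, smul_smul] at hE hE'
  have h_LLR : K * (L * (L * R)) = (q * (q + 1)) • (K * (L * (R * L)))
      - q ^ 3 • (K * (R * (L * L))) - (q ^ (n + 2) * (q + 1)) • (K * L) := by
    have h1 : ∀ X : Matrix (AttX h) (AttX h) ℂ, D * (K * X) = X := fun X => by
      rw [← mul_assoc, hD, one_mul]
    have h2 := congrArg (fun X => D * X) hE'
    simp only [mul_add, mul_sub, mul_smul_comm, h1] at h2
    linear_combination (norm := (match_scalars <;> field_simp <;> ring)) q • h2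
  simp only [pow_succ, pow_zero, one_mul, add_mul, mul_add, mul_assoc, hR, hL, hR', hL',
    mul_smul_comm, smul_mul_assoc, smul_smul, smul_add]
  constructor
  · linear_combination (norm := (match_scalars <;> field_simp <;> ring))
      (q⁻¹ ^ 2 - 1) • hE + (q⁻¹ - q⁻¹ ^ 3) • h_LLR
  · match_scalars <;> field_simp <;> ring
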